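/- For a Markov kernel P with Kantorovich norm τ(P) and probability measures μ₁, μ₂ on X, the Wasserstein distance contracts: W(μ₁P, μ₂P) ≤ τ(P)·W(μ₁, μ₂). -/

import Mathlib

open MeasureTheory ProbabilityTheory ENNReal Filter

noncomputable section

/-- `η` is a coupling of `μ` and `ν`. -/
def IsCoupling {X : Type*} [MeasurableSpace X] (η : Measure (X × X)) (μ ν : Measure X) : Prop :=
  η.map Prod.fst = μ ∧ η.map Prod.snd = ν

/-- The 1-Wasserstein distance between two measures, w.r.t. the metric of `X`. -/
def wass {X : Type*} [MeasurableSpace X] [MetricSpace X] (μ ν : Measure X) : ℝ≥0∞ :=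
  ⨅ η : {η : Measure (X × X) // IsCoupling η μ ν}, ∫⁻ p, edist p.1 p.2 ∂(η : Measure (X × X))

/-- The Kantorovich norm of a Markov kernel. -/
def tau {X : Type*} [MeasurableSpace X] [MetricSpace X] (K : Kernel X X) : ℝ≥0∞ :=
  ⨆ (x : X) (y : X) (_ : x ≠ y), wass (K x) (K y) / edist x y

open Topology

namespace IsCoupling

variable {X : Type*} [MeasurableSpace X] {μ ν : Measure X} {η : Measure (X × X)}

theorem measure_fst_preimage (h : IsCoupling η μ ν) {s : Set X} (hs : MeasurableSet s) :
    η (Prod.fst ⁻¹' s) = μ s := by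
  rw [← h.1, Measure.map_apply measurable_fst hs]

theorem measure_snd_preimage (h : IsCoupling η μ ν) {s : Set X} (hs : MeasurableSet s) :
    η (Prod.snd ⁻¹' s) = ν s := by
  rw [← h.2, Measure.map_apply measurable_snd hs]

theorem isProbabilityMeasure [IsProbabilityMeasure μ] (h : IsCoupling η μ ν) :
    IsProbabilityMeasure η :=
  ⟨by rw [← Set.preimage_univ (f := Prod.fst), h.measure_fst_preimage .univ, measure_univ]⟩

theorem prod (μ ν : Measure X) [IsProbabilityMeasure μ] [IsProbabilityMeasure ν] :
    IsCoupling (μ.prod ν) μ ν :=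
  ⟨by simp, by simp⟩

/-- A kernel of couplings, averaged over a coupling, is a coupling of the averages. -/
theorem bind (h : IsCoupling η μ ν) {κ : Kernel (X × X) (X × X)} {K L : Kernel X X}
    (hκ : ∀ p, IsCoupling (κ p) (K p.1) (L p.2)) :
    IsCoupling (η.bind κ) (μ.bind K) (ν.bind L) := by
  constructor
  · ext s hs
    rw [Measure.map_apply measurable_fst hs,
      Measure.bind_apply (measurable_fst hs) κ.aemeasurable, Measure.bind_apply hs K.aemeasurable,
      ← h.1, lintegral_map (K.measurable_coe hs) measurable_fst]
    exact lintegral_congr fun p ↦ (hκ p).measure_fst_preimage hs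
  · ext s hs
    rw [Measure.map_apply measurable_snd hs,
      Measure.bind_apply (measurable_snd hs) κ.aemeasurable, Measure.bind_apply hs L.aemeasurable,
      ← h.2, lintegral_map (L.measurable_coe hs) measurable_snd]
    exact lintegral_congr fun p ↦ (hκ p).measure_snd_preimage hs

end IsCoupling

section Wasserstein

variable {X : Type*} [MeasurableSpace X] [MetricSpace X]

theorem wass_le_lintegral {μ ν : Measure X} {η : Measure (X × X)} (h : IsCoupling η μ ν) :
    wass μ ν ≤ ∫⁻ p, edist p.1 p.2 ∂η :=
  iInf_le (fun η : {η : Measure (X × X) // IsCoupling η μ ν} ↦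
    ∫⁻ p, edist p.1 p.2 ∂(η : Measure (X × X))) ⟨η, h⟩

theorem exists_isCoupling_lintegral_lt {μ ν : Measure X} {c : ℝ≥0∞} (h : wass μ ν < c) :
    ∃ η, IsCoupling η μ ν ∧ ∫⁻ p, edist p.1 p.2 ∂η < c := by
  obtain ⟨η, hη⟩ := iInf_lt_iff.1 h
  exact ⟨η, η.2, hη⟩

/-- There are countably-valued measurable maps uniformly close to the identity. -/
theorem exists_measurable_nat_edist_lt [OpensMeasurableSpace X] [SecondCountableTopology X]
    [Nonempty X] {ε : ℝ≥0∞} (hε : 0 < ε) :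
    ∃ (e : ℕ → X) (i : X → ℕ), Measurable i ∧ ∀ x, edist (e (i x)) x < ε := by
  classical
  have hex (x : X) : ∃ k, edist (TopologicalSpace.denseSeq X k) x < ε := by
    obtain ⟨_, ⟨k, rfl⟩, hk⟩ := EMetric.mem_closure_iff.1
      (TopologicalSpace.denseRange_denseSeq X x) ε hε
    exact ⟨k, edist_comm x _ ▸ hk⟩
  refine ⟨TopologicalSpace.denseSeq X, fun x ↦ Nat.find (hex x),
    measurable_find hex fun k ↦ ?_, fun x ↦ Nat.find_spec (hex x)⟩
  exact (isOpen_lt (by fun_prop) continuous_const).measurableSet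

variable [BorelSpace X]

theorem tendsto_of_measure_le_cthickening {ν : ProbabilityMeasure X}
    {νs : ℕ → ProbabilityMeasure X} {c : ℕ → ℝ≥0∞} (hc : Tendsto c atTop (𝓝 0))
    (h : ∀ n (F : Set X), IsClosed F → ∀ δ : ℝ, 0 < δ →
      (νs n : Measure X) F ≤ (ν : Measure X) (Metric.cthickening δ F) + c n / ENNReal.ofReal δ) :
    Tendsto νs atTop (𝓝 ν) := by
  refine tendsto_of_forall_isClosed_limsup_le' fun F hF ↦ ?_
  have hlim : Tendsto (fun δ ↦ (ν : Measure X) (Metric.cthickening δ F)) (𝓝[>] 0)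
      (𝓝 ((ν : Measure X) F)) :=
    (tendsto_measure_cthickening_of_isClosed ⟨1, one_pos, measure_ne_top _ _⟩ hF).mono_left
      nhdsWithin_le_nhds
  refine ge_of_tendsto hlim ?_
  filter_upwards [self_mem_nhdsWithin] with δ hδ
  have hδ' : ENNReal.ofReal δ ≠ 0 := (ENNReal.ofReal_pos.2 hδ).ne'
  have ht : Tendsto (fun n ↦ (ν : Measure X) (Metric.cthickening δ F) + c n / ENNReal.ofReal δ)
      atTop (𝓝 ((ν : Measure X) (Metric.cthickening δ F) + 0 / ENNReal.ofReal δ)) :=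
    tendsto_const_nhds.add (ENNReal.Tendsto.div_const hc (Or.inr hδ'))
  rw [ENNReal.zero_div, add_zero] at ht
  exact (limsup_le_limsup (Eventually.of_forall fun n ↦ h n F hF δ hδ)).trans ht.limsup_eq.le

variable [SecondCountableTopology X]

theorem wass_self (μ : Measure X) : wass μ μ = 0 := by
  have h : IsCoupling (μ.map fun x ↦ (x, x)) μ μ := by
    constructor <;> rw [Measure.map_map (by fun_prop) (by fun_prop)] <;>
      exact Measure.map_id
  refine le_antisymm ((wass_le_lintegral h).trans ?_) zero_le
  rw [lintegral_map (by fun_prop) (by fun_prop)]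
  simp

theorem wass_le_tau_mul_edist (K : Kernel X X) (x y : X) :
    wass (K x) (K y) ≤ tau K * edist x y := by
  rcases eq_or_ne x y with rfl | hxy
  · simp [wass_self]
  · rw [← ENNReal.div_le_iff (edist_pos.2 hxy).ne' (edist_ne_top x y)]
    exact le_iSup_of_le x (le_iSup_of_le y (le_iSup_of_le hxy le_rfl))

theorem measure_le_measure_cthickening_add (μ ν : Measure X) {F : Set X} (hF : MeasurableSet F)
    {δ : ℝ} (hδ : 0 < δ) :
    μ F ≤ ν (Metric.cthickening δ F) + wass μ ν / ENNReal.ofReal δ := by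
  have hδ' : ENNReal.ofReal δ ≠ 0 := (ENNReal.ofReal_pos.2 hδ).ne'
  rw [wass, ENNReal.iInf_div_of_ne hδ' (by simp), ENNReal.add_iInf]
  refine le_iInf fun ⟨η, hη⟩ ↦ ?_
  rw [← hη.measure_fst_preimage hF,
    ← hη.measure_snd_preimage Metric.isClosed_cthickening.measurableSet]
  calc η (Prod.fst ⁻¹' F)
    _ ≤ η (Prod.snd ⁻¹' Metric.cthickening δ F ∪ {p | ENNReal.ofReal δ ≤ edist p.1 p.2}) := by
        refine measure_mono fun p hp ↦ ?_
        by_contra! hcon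
        simp only [Set.mem_union, Set.mem_preimage, Set.mem_ofPred_eq, not_or, not_le] at hcon
        refine hcon.1 (Metric.mem_cthickening_of_edist_le _ _ _ _ hp ?_)
        rw [edist_comm]
        exact hcon.2.le
    _ ≤ _ := (measure_union_le _ _).trans (by
        gcongr
        exact meas_ge_le_lintegral_div (by fun_prop) hδ' (by simp))

end Wasserstein

section Tight

variable {X : Type*} [MeasurableSpace X] [TopologicalSpace X] [PolishSpace X] [BorelSpace X]

theorem exists_isCompact_measure_compl_le_of_tendsto {ν : ProbabilityMeasure X}
    {νs : ℕ → ProbabilityMeasure X} (h : Tendsto νs atTop (𝓝 ν)) {ε : ℝ≥0∞} (hε : 0 < ε) :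
    ∃ K : Set X, IsCompact K ∧ ∀ n, (νs n : Measure X) Kᶜ ≤ ε := by
  let := TopologicalSpace.upgradeIsCompletelyMetrizable X
  have hcomp : IsCompact (closure (Set.range νs)) :=
    h.isCompact_insert_range.closure_of_subset (Set.subset_insert _ _)
  obtain ⟨K, hK, hKε⟩ := isTightMeasureSet_iff_exists_isCompact_measure_compl_le.1
    (isTightMeasureSet_of_isCompact_closure hcomp) ε hε
  exact ⟨K, hK, fun n ↦ hKε _ ⟨νs n, ⟨n, rfl⟩, rfl⟩⟩

/-- Couplings of weakly convergent sequences are relatively compact, and their limit points couple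
the limits. -/
theorem exists_isCoupling_tendsto_subseq {μ ν : ProbabilityMeasure X}
    {μs νs : ℕ → ProbabilityMeasure X} (hμ : Tendsto μs atTop (𝓝 μ))
    (hν : Tendsto νs atTop (𝓝 ν)) {ηs : ℕ → ProbabilityMeasure (X × X)}
    (hη : ∀ n, IsCoupling (ηs n : Measure (X × X)) (μs n) (νs n)) :
    ∃ (η : ProbabilityMeasure (X × X)) (φ : ℕ → ℕ), IsCoupling (η : Measure (X × X)) μ ν ∧
      StrictMono φ ∧ Tendsto (ηs ∘ φ) atTop (𝓝 η) := by
  have htight : IsTightMeasureSet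
      {((ρ : ProbabilityMeasure (X × X)) : Measure (X × X)) | ρ ∈ Set.range ηs} := by
    refine isTightMeasureSet_iff_exists_isCompact_measure_compl_le.2 fun ε hε ↦ ?_
    obtain ⟨K, hK, hKε⟩ := exists_isCompact_measure_compl_le_of_tendsto hμ (ENNReal.half_pos hε.ne')
    obtain ⟨L, hL, hLε⟩ := exists_isCompact_measure_compl_le_of_tendsto hν (ENNReal.half_pos hε.ne')
    refine ⟨K ×ˢ L, hK.prod hL, ?_⟩
    rintro _ ⟨_, ⟨n, rfl⟩, rfl⟩
    rw [Set.compl_prod_eq_union, Set.prod_univ, Set.univ_prod]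
    refine (measure_union_le _ _).trans ?_
    rw [(hη n).measure_fst_preimage hK.measurableSet.compl,
      (hη n).measure_snd_preimage hL.measurableSet.compl]
    exact (add_le_add (hKε n) (hLε n)).trans (ENNReal.add_halves ε).le
  obtain ⟨η, -, φ, hφ, hlim⟩ := (isCompact_closure_of_isTightMeasureSet htight).tendsto_subseq
    fun n ↦ subset_closure ⟨n, rfl⟩
  refine ⟨η, φ, ⟨?_, ?_⟩, hφ, hlim⟩
  · have h1 := ProbabilityMeasure.tendsto_map_of_tendsto_of_continuous _ _ hlim continuous_fst
    have h2 : ∀ n, ((ηs ∘ φ) n).map (continuous_fst.measurable.aemeasurable) = (μs ∘ φ) n :=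
      fun n ↦ Subtype.ext (hη (φ n)).1
    simp only [h2] at h1
    exact congrArg ProbabilityMeasure.toMeasure (tendsto_nhds_unique h1 (hμ.comp hφ.tendsto_atTop))
  · have h1 := ProbabilityMeasure.tendsto_map_of_tendsto_of_continuous _ _ hlim continuous_snd
    have h2 : ∀ n, ((ηs ∘ φ) n).map (continuous_snd.measurable.aemeasurable) = (νs ∘ φ) n :=
      fun n ↦ Subtype.ext (hη (φ n)).2
    simp only [h2] at h1
    exact congrArg ProbabilityMeasure.toMeasure (tendsto_nhds_unique h1 (hν.comp hφ.tendsto_atTop))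

end Tight

section Contraction

variable {X : Type*} [MeasurableSpace X] [MetricSpace X] [PolishSpace X] [BorelSpace X]

theorem wass_le_of_tendsto {μ ν : ProbabilityMeasure X}
    {μs νs : ℕ → ProbabilityMeasure X} (hμ : Tendsto μs atTop (𝓝 μ))
    (hν : Tendsto νs atTop (𝓝 ν)) {ηs : ℕ → Measure (X × X)}
    (hη : ∀ n, IsCoupling (ηs n) (μs n : Measure X) (νs n)) {c : ℕ → ℝ≥0∞} {C : ℝ≥0∞}
    (hcost : ∀ n, ∫⁻ p, edist p.1 p.2 ∂ηs n ≤ c n) (hc : Tendsto c atTop (𝓝 C)) :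
    wass (μ : Measure X) ν ≤ C := by
  obtain ⟨η, φ, hcoup, hφ, hlim⟩ := exists_isCoupling_tendsto_subseq hμ hν
    (ηs := fun n ↦ ⟨ηs n, (hη n).isProbabilityMeasure⟩) hη
  have hliminf := lintegral_le_liminf_lintegral_of_forall_isOpen_measure_le_liminf_measure
    (f := fun p : X × X ↦ dist p.1 p.2) (by fun_prop) (fun _ ↦ dist_nonneg)
    fun G hG ↦ ProbabilityMeasure.le_liminf_measure_open_of_tendsto hlim hG
  simp only [← edist_dist] at hliminf
  refine (wass_le_lintegral hcoup).trans (hliminf.trans ?_)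
  exact (liminf_le_liminf (Eventually.of_forall fun n ↦ hcost (φ n))).trans
    (hc.comp hφ.tendsto_atTop).liminf_eq.le

/-- Near-optimal couplings of the rows of a kernel can be chosen measurably after the starting
points are discretized. -/
theorem exists_isCoupling_bind_comap_le {P : Kernel X X} (hfin : tau P < ∞) {μ ν : Measure X}
    [IsProbabilityMeasure μ] {η : Measure (X × X)} (hη : IsCoupling η μ ν) {e : ℕ → X} {i : X → ℕ}
    (hi : Measurable i) {ε : ℝ≥0∞} (hε : 0 < ε) (he : ∀ x, edist (e (i x)) x < ε) :
    ∃ ζ, IsCoupling ζ (μ.bind (P.comap (e ∘ i) (measurable_from_nat.comp hi)))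
        (ν.bind (P.comap (e ∘ i) (measurable_from_nat.comp hi))) ∧
      ∫⁻ p, edist p.1 p.2 ∂ζ ≤ tau P * ∫⁻ p, edist p.1 p.2 ∂η + (tau P * 2 + 1) * ε := by
  have := hη.isProbabilityMeasure
  have hex (q : ℕ × ℕ) : ∃ γ, IsCoupling γ (P (e q.1)) (P (e q.2)) ∧
      ∫⁻ p, edist p.1 p.2 ∂γ < tau P * edist (e q.1) (e q.2) + ε := by
    refine exists_isCoupling_lintegral_lt ((wass_le_tau_mul_edist P _ _).trans_lt ?_)
    exact ENNReal.lt_add_right (ENNReal.mul_ne_top hfin.ne (edist_ne_top _ _)) hε.ne'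
  choose γ hγ hγcost using hex
  let κ : Kernel (X × X) (X × X) := (Kernel.ofFunOfCountable γ).comap (Prod.map i i) (by fun_prop)
  refine ⟨η.bind κ, hη.bind fun p ↦ hγ (i p.1, i p.2), ?_⟩
  rw [Measure.lintegral_bind κ.aemeasurable (by fun_prop)]
  calc ∫⁻ p, ∫⁻ q, edist q.1 q.2 ∂κ p ∂η
    _ ≤ ∫⁻ p, (tau P * edist p.1 p.2 + (tau P * 2 + 1) * ε) ∂η := by
        refine lintegral_mono fun p ↦ (hγcost (i p.1, i p.2)).le.trans ?_
        calc tau P * edist (e (i p.1)) (e (i p.2)) + ε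
          _ ≤ tau P * (ε + edist p.1 p.2 + ε) + ε := by
              gcongr
              refine (edist_triangle4 _ p.1 p.2 _).trans ?_
              gcongr
              · exact (he _).le
              · rw [edist_comm]
                exact (he _).le
          _ = _ := by ring
    _ = _ := by
        rw [lintegral_add_right _ measurable_const, lintegral_const_mul _ (by fun_prop)]
        simp

/-- Averages of a kernel with finite Kantorovich norm over uniformly close discretizations
converge weakly. -/
theorem tendsto_bind_comap {P : Kernel X X} [IsMarkovKernel P] (hfin : tau P < ∞)
    (μ : Measure X) [IsProbabilityMeasure μ] {f : ℕ → X → X} (hf : ∀ n, Measurable (f n))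
    {ε : ℕ → ℝ≥0∞} (hε : Tendsto ε atTop (𝓝 0)) (hfε : ∀ n x, edist (f n x) x ≤ ε n) :
    Tendsto (β := ProbabilityMeasure X)
      (fun n ↦ ⟨μ.bind (P.comap (f n) (hf n)), inferInstance⟩) atTop
      (nhds (X := ProbabilityMeasure X) ⟨μ.bind P, inferInstance⟩) := by
  have hc : Tendsto (fun n ↦ tau P * ε n) atTop (𝓝 0) := by
    simpa using ENNReal.Tendsto.const_mul hε (Or.inr hfin.ne)
  refine tendsto_of_measure_le_cthickening hc fun n F hF δ hδ ↦ ?_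
  have hm : MeasurableSet (Metric.cthickening δ F) := Metric.isClosed_cthickening.measurableSet
  simp only [ProbabilityMeasure.coe_mk]
  rw [Measure.bind_apply hF.measurableSet (Kernel.aemeasurable _),
    Measure.bind_apply hm P.aemeasurable]
  calc ∫⁻ x, P.comap (f n) (hf n) x F ∂μ
    _ ≤ ∫⁻ x, (P x (Metric.cthickening δ F) + tau P * ε n / ENNReal.ofReal δ) ∂μ := by
        refine lintegral_mono fun x ↦ ?_
        refine (measure_le_measure_cthickening_add (P (f n x)) (P x) hF.measurableSet hδ).trans ?_
        gcongr
        exact (wass_le_tau_mul_edist P _ _).trans (by gcongr; exact hfε n x)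
    _ = _ := by
        rw [lintegral_add_right _ measurable_const]
        simp

theorem wass_bind_le_tau_mul_lintegral {P : Kernel X X} [IsMarkovKernel P] (hfin : tau P < ∞)
    {μ ν : Measure X} [IsProbabilityMeasure μ] [IsProbabilityMeasure ν] {η : Measure (X × X)}
    (hη : IsCoupling η μ ν) :
    wass (μ.bind P) (ν.bind P) ≤ tau P * ∫⁻ p, edist p.1 p.2 ∂η := by
  have : Nonempty X := nonempty_of_isProbabilityMeasure μ
  have hε (n : ℕ) : 0 < ((n : ℝ≥0∞))⁻¹ := by simp
  choose e i hi hei using fun n ↦ exists_measurable_nat_edist_lt (X := X) (hε n)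
  choose ζ hζ hcost using fun n ↦ exists_isCoupling_bind_comap_le hfin hη (hi n) (hε n) (hei n)
  have hlim (ρ : Measure X) [IsProbabilityMeasure ρ] :=
    tendsto_bind_comap hfin ρ (fun n ↦ measurable_from_nat.comp (hi n))
      ENNReal.tendsto_inv_nat_nhds_zero fun n x ↦ (hei n x).le
  refine wass_le_of_tendsto (hlim μ) (hlim ν) hζ hcost ?_
  have hC : tau P * 2 + 1 ≠ ∞ := by finiteness
  simpa using tendsto_const_nhds.add
    (ENNReal.Tendsto.const_mul ENNReal.tendsto_inv_nat_nhds_zero (Or.inr hC))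

end Contraction

/-- the Wasserstein distance contracts under a Markov kernel with
finite Kantorovich norm: `W(μ₁P, μ₂P) ≤ τ(P)·W(μ₁, μ₂)`. -/
theorem wass_bind_le {X : Type*} [MeasurableSpace X] [MetricSpace X]
    [PolishSpace X] [BorelSpace X]
    (P : Kernel X X) [IsMarkovKernel P] (hfin : tau P < ∞)
    (μ₁ μ₂ : Measure X) [IsProbabilityMeasure μ₁] [IsProbabilityMeasure μ₂] :
    wass (μ₁.bind P) (μ₂.bind P) ≤ tau P * wass μ₁ μ₂ := by
  rw [wass.eq_def μ₁ μ₂,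
    ENNReal.mul_iInf' (fun h ↦ absurd h hfin.ne) fun _ ↦ ⟨_, IsCoupling.prod μ₁ μ₂⟩]
  exact le_iInf fun η ↦ wass_bind_le_tau_mul_lintegral hfin η.2
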